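/- Let Ω ⊂ ℝ^d be a measurable set of finite Lebesgue measure |Ω|, let J : Ω × Ω → [0, ∞) be measurable with ∫_Ω J(x,y) dy ≤ K_J for almost every x ∈ Ω, and let A : ℝ → ℝ be Lipschitz continuous with constant L_A and bounded with |A(s)| ≤ M_A for all s ∈ ℝ. Let q, r > 0 and let Q_q, Q_r : ℝ → ℝ be Borel functions (quantizers) with |s − Q_q(s)| ≤ q/2 and |s − Q_r(s)| ≤ r/2 for all s ∈ ℝ. Then for every bounded measurable v : Ω → ℝ and almost every x ∈ Ω, | ∫_Ω J(x,y) A(v(y) − v(x)) dy − ∫_Ω Q_r(J(x,y)) A( Q_q(v(y)) − Q_q(v(x)) ) dy | ≤ L_A q ( K_J + r |Ω| / 2 ) + M_A r |Ω| / 2. -/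

import Mathlib

open MeasureTheory

/-- quantization-error bound for the rearrangement-based (RR) quantized
nonlocal operator: for a.e. `x ∈ Ω`,
`|𝒜(v)(x) − 𝒜^R(v)(x)| ≤ L_A q (K_J + r|Ω|/2) + M_A r |Ω|/2`. -/
theorem stmt6 (d : ℕ) (Ω : Set (Fin d → ℝ)) (hΩ : MeasurableSet Ω) (hΩfin : volume Ω < ⊤)
    (J : (Fin d → ℝ) → (Fin d → ℝ) → ℝ) (hJmeas : Measurable (Function.uncurry J))
    (hJ0 : ∀ x y, 0 ≤ J x y) (KJ : ℝ)
    (hK : ∀ᵐ x ∂(volume.restrict Ω),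
      IntegrableOn (fun y => J x y) Ω ∧ (∫ y in Ω, J x y) ≤ KJ)
    (LA : NNReal) (A : ℝ → ℝ) (hA : LipschitzWith LA A)
    (MA : ℝ) (hAb : ∀ s, |A s| ≤ MA)
    (q r : ℝ) (hq : 0 < q) (hr : 0 < r)
    (Qq Qr : ℝ → ℝ) (hQqmeas : Measurable Qq) (hQrmeas : Measurable Qr)
    (hQq : ∀ s, |s - Qq s| ≤ q / 2) (hQr : ∀ s, |s - Qr s| ≤ r / 2)
    (v : (Fin d → ℝ) → ℝ) (hvmeas : Measurable v) (hvb : ∃ C, ∀ x, |v x| ≤ C) :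
    ∀ᵐ x ∂(volume.restrict Ω),
      |(∫ y in Ω, J x y * A (v y - v x)) - ∫ y in Ω, Qr (J x y) * A (Qq (v y) - Qq (v x))|
        ≤ (LA : ℝ) * q * (KJ + r * (volume Ω).toReal / 2)
            + MA * r * (volume Ω).toReal / 2 := by
  have hMA : 0 ≤ MA := (abs_nonneg _).trans (hAb 0)
  have : IsFiniteMeasure (volume.restrict Ω) := ⟨by simpa using hΩfin⟩
  have hAm : Measurable A := hA.continuous.measurable
  filter_upwards [hK] with x ⟨hint, hle⟩
  have hJx : Measurable (J x) := hJmeas.comp measurable_prodMk_left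
  have hQJ (y) : |Qr (J x y)| ≤ J x y + r / 2 := by
    have h := abs_le.1 (hQr (J x y))
    have h0 := hJ0 x y
    rw [abs_le]
    constructor <;> linarith
  have hAdiff (y) : |A (v y - v x) - A (Qq (v y) - Qq (v x))| ≤ LA * q := by
    have h := hA.dist_le_mul (v y - v x) (Qq (v y) - Qq (v x))
    rw [Real.dist_eq, Real.dist_eq] at h
    refine h.trans (mul_le_mul_of_nonneg_left ?_ LA.coe_nonneg)
    have hy := abs_le.1 (hQq (v y))
    have hx := abs_le.1 (hQq (v x))
    rw [abs_le]
    constructor <;> linarith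
  have hJr : Integrable (fun y => J x y + r / 2) (volume.restrict Ω) :=
    Integrable.add hint (integrable_const _)
  have hexact : Integrable (fun y => J x y * A (v y - v x)) (volume.restrict Ω) := by
    refine Integrable.mono' (Integrable.mul_const hint MA)
      (hJx.mul (hAm.comp (hvmeas.sub_const _))).aestronglyMeasurable (.of_forall fun y => ?_)
    rw [Real.norm_eq_abs, abs_mul, abs_of_nonneg (hJ0 x y)]
    exact mul_le_mul_of_nonneg_left (hAb _) (hJ0 x y)
  have hquant : Integrable (fun y => Qr (J x y) * A (Qq (v y) - Qq (v x)))
      (volume.restrict Ω) := by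
    refine Integrable.mono' (hJr.mul_const MA)
      ((hQrmeas.comp hJx).mul
        (hAm.comp ((hQqmeas.comp hvmeas).sub_const _))).aestronglyMeasurable
      (.of_forall fun y => ?_)
    rw [Real.norm_eq_abs, abs_mul]
    exact mul_le_mul (hQJ y) (hAb _) (abs_nonneg _) ((abs_nonneg _).trans (hQJ y))
  rw [← integral_sub hexact hquant, ← Real.norm_eq_abs]
  calc
    _ ≤ ∫ y in Ω, ((J x y + r / 2) * (LA * q) + r / 2 * MA) := by
      refine norm_integral_le_of_norm_le ((hJr.mul_const _).add (integrable_const _))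
        (.of_forall fun y => ?_)
      rw [Real.norm_eq_abs, show J x y * A (v y - v x) - Qr (J x y) * A (Qq (v y) - Qq (v x)) =
        Qr (J x y) * (A (v y - v x) - A (Qq (v y) - Qq (v x))) +
          (J x y - Qr (J x y)) * A (v y - v x) by ring]
      refine (abs_add_le _ _).trans (add_le_add ?_ ?_) <;> rw [abs_mul]
      · exact mul_le_mul (hQJ y) (hAdiff y) (abs_nonneg _) ((abs_nonneg _).trans (hQJ y))
      · exact mul_le_mul (hQr _) (hAb _) (abs_nonneg _) (by positivity)
    _ = LA * q * ((∫ y in Ω, J x y) + r * (volume Ω).toReal / 2)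
          + MA * r * (volume Ω).toReal / 2 := by
      rw [integral_add (hJr.mul_const _) (integrable_const _), integral_mul_const,
        integral_add hint (integrable_const _), setIntegral_const, setIntegral_const]
      simp only [smul_eq_mul, Measure.real]
      ring
    _ ≤ _ := by gcongr
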